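/- arXiv:0902.1267 — 3 statements merged into one kernel-verified Lean document; each statement's English description precedes it below -/
import Mathlib

section
/- For every integer x with 0 ≤ x ≤ p−1, the vector φ_x is an eigenvector of the discrete Fourier transform with eigenvalue (−i)^x, where i = √−1: F φ_x = (−i)^x · φ_x. -/
open Complex in
theorem Complex.ofReal_mul_cpow_of_pos {r : ℝ} (hr : 0 < r) {z : ℂ} (hz : z ≠ 0) (c : ℂ) :
    ((r : ℂ) * z) ^ c = (r : ℂ) ^ c * z ^ c := by
  have hr' : (r : ℂ) ≠ 0 := ofReal_ne_zero.2 hr.ne'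
  rw [cpow_def_of_ne_zero (mul_ne_zero hr' hz), cpow_def_of_ne_zero hr', cpow_def_of_ne_zero hz,
    log_ofReal_mul hr hz, ← ofReal_log hr.le, ← exp_add, add_mul]

theorem summable_exp_neg_pi_mul_int_sq {w : ℂ} (hw : 0 < w.re) :
    Summable fun n : ℤ ↦ Complex.exp (-Real.pi * w * n ^ 2) := by
  have h := (summable_jacobiTheta₂_term_iff 0 (Complex.I * w)).2 (by simpa using hw)
  refine h.congr fun n ↦ ?_
  rw [jacobiTheta₂_term]
  congr 1
  linear_combination (Real.pi * n ^ 2 * w) * Complex.I_sq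

open Filter Topology Complex in
/-- A shifted Gaussian sum over a lattice of step `N` grows like `1 / (N √w)`. -/
theorem tendsto_cpow_mul_tsum_exp_neg_sq {ι : Type*} {l : Filter ι} {w : ι → ℂ}
    (hw : Tendsto (fun t ↦ ((w t)⁻¹).re) l atTop) (N : ℕ) [NeZero N] (r : ℤ) :
    Tendsto (fun t ↦ w t ^ (1 / 2 : ℂ) *
      ∑' n : ℤ, cexp (-Real.pi * w t * ((n * N + r : ℤ) : ℂ) ^ 2)) l (𝓝 (1 / N)) := by
  have hN : (0 : ℝ) < N := Nat.cast_pos.2 (NeZero.pos N)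
  have hNC : (N : ℂ) ≠ 0 := NeZero.ne _
  have key : Tendsto (fun t ↦ ∑' n : ℤ,
      cexp (-Real.pi * ((w t)⁻¹ / N ^ 2) * n ^ 2 + 2 * Real.pi * I * n * r / N)) l
      (𝓝 (∑' n : ℤ, if n = 0 then 1 else 0)) := by
    have hnorm (t : ι) (n : ℤ) :
        ‖cexp (-Real.pi * ((w t)⁻¹ / N ^ 2) * n ^ 2 + 2 * Real.pi * I * n * r / N)‖ =
          Real.exp (-(Real.pi * n ^ 2 / N ^ 2) * ((w t)⁻¹).re) := by
      rw [exp_add, norm_mul]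
      have h1 : 2 * Real.pi * I * n * r / N = ((2 * Real.pi * n * r / N : ℝ) : ℂ) * I := by
        push_cast; ring
      have h2 : -Real.pi * ((w t)⁻¹ / N ^ 2) * n ^ 2 =
          ((-(Real.pi * n ^ 2 / N ^ 2) : ℝ) : ℂ) * (w t)⁻¹ := by
        push_cast; ring
      rw [h1, norm_exp_ofReal_mul_I, mul_one, h2, norm_exp, re_ofReal_mul]
    refine tendsto_tsum_of_dominated_convergence
      (bound := fun n : ℤ ↦ ‖cexp (-Real.pi * (1 : ℂ) * n ^ 2)‖)
      (summable_exp_neg_pi_mul_int_sq (by simp)).norm (fun n ↦ ?_) ?_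
    · split_ifs with hn
      · subst hn
        simpa using tendsto_const_nhds
      · rw [tendsto_zero_iff_norm_tendsto_zero]
        simp_rw [hnorm]
        refine Real.tendsto_exp_atBot.comp (hw.const_mul_atTop_of_neg ?_)
        have : (n : ℝ) ≠ 0 := Int.cast_ne_zero.2 hn
        have := Real.pi_pos
        have : 0 < Real.pi * n ^ 2 / N ^ 2 := by positivity
        linarith
    · filter_upwards [hw.eventually_ge_atTop ((N : ℝ) ^ 2)] with t ht n
      rw [hnorm, show -Real.pi * (1 : ℂ) * n ^ 2 = ((-(Real.pi * n ^ 2) : ℝ) : ℂ) by push_cast; ring,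
        norm_exp, ofReal_re, Real.exp_le_exp, neg_mul, neg_le_neg_iff, div_mul_eq_mul_div,
        le_div_iff₀ (by positivity)]
      gcongr
  rw [tsum_ite_eq] at key
  have key' := key.const_mul (1 / (N : ℂ))
  rw [mul_one] at key'
  refine key'.congr' ?_
  filter_upwards [hw.eventually_gt_atTop 0] with t ht
  have hw0 : w t ≠ 0 := by
    rintro h
    simp [h] at ht
  have hre : 0 < (w t).re := by
    rw [inv_re] at ht
    exact (div_pos_iff_of_pos_right (normSq_pos.2 hw0)).1 ht
  have ha : 0 < (((N ^ 2 : ℝ) : ℂ) * w t).re := by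
    rw [re_ofReal_mul]
    positivity
  have hP := tsum_exp_neg_quadratic ha (-(N * r * w t))
  have h1 (n : ℤ) : cexp (-Real.pi * w t * ((n * N + r : ℤ) : ℂ) ^ 2) =
      cexp (-Real.pi * w t * r ^ 2) * cexp (-Real.pi * (((N ^ 2 : ℝ) : ℂ) * w t) * n ^ 2 +
        2 * Real.pi * (-(N * r * w t)) * n) := by
    rw [← exp_add]
    congr 1
    push_cast
    ring
  have h2 (n : ℤ) : cexp (-Real.pi / (((N ^ 2 : ℝ) : ℂ) * w t) * (n + I * -(N * r * w t)) ^ 2) =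
      cexp (Real.pi * w t * r ^ 2) *
        cexp (-Real.pi * ((w t)⁻¹ / N ^ 2) * n ^ 2 + 2 * Real.pi * I * n * r / N) := by
    rw [← exp_add]
    congr 1
    push_cast
    field_simp
    ring_nf
    rw [I_sq]
    ring
  have h3 : (((N ^ 2 : ℝ) : ℂ)) ^ (1 / 2 : ℂ) = N := by
    rw [show ((1 / 2 : ℂ)) = ((1 / 2 : ℝ) : ℂ) by push_cast; rfl, ← ofReal_cpow (by positivity),
      ← Real.sqrt_eq_rpow, Real.sqrt_sq hN.le, ofReal_natCast]
  have h4 : w t ^ (1 / 2 : ℂ) ≠ 0 := by simp [cpow_eq_zero_iff, hw0]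
  have h5 : cexp (-Real.pi * w t * r ^ 2) * cexp (Real.pi * w t * r ^ 2) = 1 := by
    rw [← exp_add]
    simp
  simp_rw [h1, tsum_mul_left]
  rw [hP]
  simp_rw [h2, tsum_mul_left]
  rw [ofReal_mul_cpow_of_pos (by positivity) hw0, h3]
  generalize (∑' n : ℤ,
    cexp (-Real.pi * ((w t)⁻¹ / N ^ 2) * n ^ 2 + 2 * Real.pi * I * n * r / N)) = S
  generalize cexp (-Real.pi * w t * r ^ 2) = A at h5 ⊢
  generalize cexp (Real.pi * w t * r ^ 2) = B at h5 ⊢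
  field_simp
  linear_combination -S * h5

open Filter Topology Complex in
/-- A Gaussian sum with `N`-periodic weights grows like the mean of the weights over `√w`. -/
theorem tendsto_cpow_mul_tsum_periodic_mul_exp_neg_sq {ι : Type*} {l : Filter ι} {w : ι → ℂ}
    (hw : Tendsto (fun t ↦ ((w t)⁻¹).re) l atTop) (N : ℕ) [NeZero N] {c : ℤ → ℂ}
    (hc : ∀ n r : ℤ, c (n * N + r) = c r) :
    Tendsto (fun t ↦ w t ^ (1 / 2 : ℂ) * ∑' n : ℤ, c n * cexp (-Real.pi * w t * n ^ 2)) l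
      (𝓝 ((∑ r : Fin N, c (r : ℕ)) / N)) := by
  have h := tendsto_finsetSum (Finset.univ : Finset (Fin N)) fun r _ ↦
    (tendsto_cpow_mul_tsum_exp_neg_sq hw N (r : ℕ)).const_mul (c (r : ℕ))
  rw [← Finset.sum_mul, mul_one_div] at h
  refine h.congr' ?_
  filter_upwards [hw.eventually_gt_atTop 0] with t ht
  have hw0 : w t ≠ 0 := by
    rintro h
    simp [h] at ht
  have hre : 0 < (w t).re := by
    rw [inv_re] at ht
    exact (div_pos_iff_of_pos_right (normSq_pos.2 hw0)).1 ht
  have hs := summable_exp_neg_pi_mul_int_sq hre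
  have hcs : Summable fun n : ℤ ↦ c n * cexp (-Real.pi * w t * n ^ 2) := by
    refine Summable.of_norm_bounded (hs.norm.mul_left (∑ r : Fin N, ‖c (r : ℕ)‖)) fun n ↦ ?_
    rw [norm_mul]
    gcongr
    have hn : c n = c (((Int.divModEquiv N n).2 : ℕ) : ℤ) := by
      conv_lhs => rw [← (Int.divModEquiv N).symm_apply_apply n]
      rw [Int.divModEquiv_symm_apply, hc]
    rw [hn]
    exact Finset.single_le_sum (f := fun r : Fin N ↦ ‖c (r : ℕ)‖) (fun _ _ ↦ norm_nonneg _)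
      (Finset.mem_univ _)
  obtain ⟨e, he⟩ : ∃ e : Fin N × ℤ ≃ ℤ, ∀ q, e q = q.2 * N + (q.1 : ℕ) :=
    ⟨(Equiv.prodComm (Fin N) ℤ).trans (Int.divModEquiv N).symm, fun _ ↦ rfl⟩
  have hcs' : Summable fun q : Fin N × ℤ ↦ c (e q) * cexp (-Real.pi * w t * (e q) ^ 2) :=
    e.summable_iff.2 hcs
  rw [← e.tsum_eq, hcs'.tsum_prod, tsum_fintype, Finset.mul_sum]
  refine Finset.sum_congr rfl fun r _ ↦ ?_
  simp only [he, hc, tsum_mul_left]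
  ring

open Filter Topology Complex in
/-- Gauss's evaluation of the quadratic Gauss sum, sign included, for a modulus `N ≡ 1 (mod 4)`. -/
theorem sum_fin_exp_sq_eq_sqrt {N : ℕ} [NeZero N] (hN : N % 4 = 1) :
    ∑ r : Fin N, cexp (2 * Real.pi * I * (r : ℕ) ^ 2 / N) = Real.sqrt N := by
  have hN0 : (0 : ℝ) < N := Nat.cast_pos.2 (NeZero.pos N)
  have hNC : (N : ℂ) ≠ 0 := NeZero.ne _
  set a : ℝ → ℂ := fun t ↦ t - 2 * I / N with ha
  set v : ℝ → ℂ := fun t ↦ -I * N / (2 * a t) with hv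
  clear_value v a
  have hare (t : ℝ) : (a t).re = t := by
    have : a t = ((t : ℝ) : ℂ) + ((-2 / N : ℝ) : ℂ) * I := by
      simp only [ha]; push_cast; ring
    rw [this]
    simp
  have ha0' : a 0 = -2 * I / N := by simp [ha, neg_div]
  have hane {t : ℝ} (ht : 0 < t) : a t ≠ 0 := fun h ↦ by
    have := hare t
    rw [h] at this
    exact ht.ne this
  have hvne {t : ℝ} (ht : 0 < t) : v t ≠ 0 := by
    have := hane ht
    simp only [hv]
    refine div_ne_zero (mul_ne_zero (neg_ne_zero.2 I_ne_zero) hNC) (by simpa)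
  have hacont : Tendsto a (𝓝[>] 0) (𝓝 (-2 * I / N)) := by
    rw [← ha0']
    refine (Continuous.tendsto ?_ 0).mono_left nhdsWithin_le_nhds
    rw [ha]
    fun_prop
  have hvcont : Tendsto v (𝓝[>] 0) (𝓝 (((N : ℝ) / 2) ^ 2 : ℝ)) := by
    have h : ((((N : ℝ) / 2) ^ 2 : ℝ) : ℂ) = -I * N / (2 * (-2 * I / N)) := by
      push_cast
      have := I_ne_zero
      field_simp
    rw [h, hv]
    refine tendsto_const_nhds.div (hacont.const_mul 2) ?_
    have := I_ne_zero
    simp [hNC]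
  have hinv {t : ℝ} (ht : 0 < t) : (a t)⁻¹ = I * N / 2 + t * v t := by
    have h1 := hane ht
    have h2 : a t * N = t * N - 2 * I := by simp only [ha]; field_simp
    simp only [hv]
    field_simp
    linear_combination (-I) * h2 + 2 * I_sq
  have hre_t : Tendsto (fun t : ℝ ↦ ((t : ℂ)⁻¹).re) (𝓝[>] 0) atTop := by
    simp_rw [← ofReal_inv, ofReal_re]
    exact tendsto_inv_nhdsGT_zero
  have hre_v : Tendsto (fun t : ℝ ↦ ((t * v t : ℂ)⁻¹).re) (𝓝[>] 0) atTop := by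
    refine (tendsto_inv_nhdsGT_zero (𝕜 := ℝ)).const_mul_atTop
      (show 0 < 4 / (N : ℝ) ^ 2 by positivity) |>.congr' ?_
    filter_upwards [self_mem_nhdsWithin] with t ht
    have ht : 0 < t := ht
    have htC : (t : ℂ) ≠ 0 := ofReal_ne_zero.2 ht.ne'
    have : (t * v t : ℂ)⁻¹ = ((4 / N ^ 2 * t⁻¹ : ℝ) : ℂ) + ((2 / N : ℝ) : ℂ) * I := by
      have h1 := hane ht
      have h2 : a t * N = t * N - 2 * I := by simp only [ha]; field_simp
      have := I_ne_zero
      simp only [hv]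
      push_cast
      field_simp
      linear_combination -2 * h2 - 2 * t * N * I_sq
    rw [this, add_re, re_ofReal_mul, I_re, mul_zero, add_zero, ofReal_re]
  have hper1 (n r : ℤ) : cexp (2 * Real.pi * I * ((n * N + r : ℤ) : ℂ) ^ 2 / N) =
      cexp (2 * Real.pi * I * r ^ 2 / N) := by
    refine exp_eq_exp_iff_exists_int.2 ⟨n ^ 2 * N + 2 * n * r, ?_⟩
    push_cast
    field_simp
    ring
  have hper2 (n r : ℤ) : cexp (-Real.pi * I * N / 2 * ((n * (2 : ℕ) + r : ℤ) : ℂ) ^ 2) =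
      cexp (-Real.pi * I * N / 2 * r ^ 2) := by
    refine exp_eq_exp_iff_exists_int.2 ⟨-N * (n ^ 2 + n * r), ?_⟩
    push_cast
    ring
  have hlim1 := tendsto_cpow_mul_tsum_periodic_mul_exp_neg_sq hre_t N
    (c := fun n ↦ cexp (2 * Real.pi * I * n ^ 2 / N)) hper1
  have hlim2 := tendsto_cpow_mul_tsum_periodic_mul_exp_neg_sq hre_v 2
    (c := fun n ↦ cexp (-Real.pi * I * N / 2 * n ^ 2)) hper2
  have hexp : cexp (-Real.pi * I * N / 2) = -I := by
    obtain ⟨m, hm⟩ : ∃ m, N = 4 * m + 1 := ⟨N / 4, by omega⟩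
    have : -Real.pi * I * N / 2 = -Real.pi / 2 * I + ((-m : ℤ) : ℂ) * (2 * Real.pi * I) := by
      rw [hm]
      push_cast
      ring
    rw [this, exp_add, exp_int_mul_two_pi_mul_I, mul_one, exp_neg_pi_div_two_mul_I]
  have hmean : (∑ r : Fin 2, cexp (-Real.pi * I * N / 2 * (((r : ℕ) : ℤ) : ℂ) ^ 2)) / (2 : ℕ) =
      (1 - I) / 2 := by
    rw [Fin.sum_univ_two]
    simp only [Fin.val_zero, Fin.val_one, Nat.cast_zero, Nat.cast_one, Int.cast_zero, Int.cast_one,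
      one_pow, mul_one, hexp]
    norm_num
    ring
  rw [hmean] at hlim2
  have hsN : (Real.sqrt N : ℂ) ^ 2 = N := by
    rw [← ofReal_pow, Real.sq_sqrt hN0.le, ofReal_natCast]
  have hsN0 : (Real.sqrt N : ℂ) ≠ 0 := ofReal_ne_zero.2 (Real.sqrt_pos.2 hN0).ne'
  have hsqrt : (-2 * I / N) ^ (1 / 2 : ℂ) = (1 - I) / Real.sqrt N := by
    have h : -2 * I / N = ((1 - I) / Real.sqrt N) ^ 2 := by
      rw [div_pow, hsN]
      congr 1
      linear_combination -I_sq
    rw [h, one_div, sq_cpow_two_inv]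
    rw [div_ofReal_re]
    have := Real.sqrt_pos.2 hN0
    simpa
  have hsq2 : ((((N : ℝ) / 2) ^ 2 : ℝ) : ℂ) ^ (1 / 2 : ℂ) = N / 2 := by
    rw [ofReal_pow, one_div, sq_cpow_two_inv]
    · push_cast
      rfl
    · rw [ofReal_re]
      positivity
  have hslit : -2 * I / (N : ℂ) ∈ slitPlane := by
    rw [mem_slitPlane_iff, ← ofReal_natCast, div_ofReal_im]
    right
    simp [NeZero.ne N]
  have hacpow := (continuousAt_cpow_const (b := 1 / 2) hslit).tendsto.comp hacont
  have hvcpow := (continuousAt_cpow_const (b := 1 / 2)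
    (ofReal_mem_slitPlane.2 (show 0 < ((N : ℝ) / 2) ^ 2 by positivity))).tendsto.comp hvcont
  rw [hsqrt] at hacpow
  rw [hsq2] at hvcpow
  have hlim3 := (hlim1.mul hacpow).mul hvcpow
  have heq := tendsto_nhds_unique (hlim3.congr' ?_) hlim2
  · have hI : (1 - I : ℂ) ≠ 0 := fun h ↦ by simpa using congrArg re h
    simp only [Int.cast_natCast] at heq
    field_simp at heq
    exact heq
  · filter_upwards [self_mem_nhdsWithin] with t ht
    have ht : 0 < t := ht
    have h1 (n : ℤ) : cexp (2 * Real.pi * I * n ^ 2 / N) * cexp (-Real.pi * t * n ^ 2) =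
        cexp (-Real.pi * a t * n ^ 2) := by
      rw [← exp_add, ha]
      congr 1
      ring
    have h2 (n : ℤ) : cexp (-Real.pi * I * N / 2 * n ^ 2) * cexp (-Real.pi * (t * v t) * n ^ 2) =
        cexp (-Real.pi / a t * n ^ 2) := by
      rw [← exp_add, div_eq_mul_inv _ (a t), hinv ht]
      congr 1
      ring
    have h3 : a t ^ (1 / 2 : ℂ) ≠ 0 := by simp [cpow_eq_zero_iff, hane ht]
    simp only [h1, h2, Function.comp_apply]
    rw [tsum_exp_neg_mul_int_sq (by rwa [hare]), ofReal_mul_cpow_of_pos ht (hvne ht)]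
    field_simp

theorem ZMod.sum_stdAddChar_sq {N : ℕ} [NeZero N] (hN : N % 4 = 1) :
    ∑ i : ZMod N, stdAddChar (i ^ 2) = (Real.sqrt N : ℂ) := by
  rw [← sum_fin_exp_sq_eq_sqrt hN, ← (ZMod.finEquiv N).toEquiv.sum_comp]
  refine Finset.sum_congr rfl fun r _ ↦ ?_
  have hr : ((ZMod.finEquiv N).toEquiv r) = ((((r : ℕ) : ℤ)) : ZMod N) := by
    obtain _ | n := N
    · exact (NeZero.ne 0 rfl).elim
    · rw [Int.cast_natCast]
      exact (Fin.cast_val_eq_self r).symm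
  rw [hr, ← Int.cast_pow, stdAddChar_coe]
  push_cast
  rfl

theorem ZMod.two_ne_zero_of_mod_four_eq_one {p : ℕ} [Fact p.Prime] (hp : p % 4 = 1) :
    (2 : ZMod p) ≠ 0 := by
  have : Fact (2 < p) := ⟨by have := (Fact.out : p.Prime).two_le; omega⟩
  refine fun h ↦ ZMod.neg_one_ne_one (n := p) ?_
  linear_combination -h

/-- The Fourier transform of the chirp `i ↦ e(c i² / 2)`, where `c` is a square root of `-1`. -/
theorem ZMod.sum_stdAddChar_chirp {p : ℕ} [Fact p.Prime] (hp : p % 4 = 1) {c : ZMod p}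
    (hc : c ^ 2 = -1) (m : ZMod p) :
    ∑ i : ZMod p, stdAddChar (2⁻¹ * c * i ^ 2 + i * m) =
      Real.sqrt p * stdAddChar (2⁻¹ * c * m ^ 2) := by
  have h2 := two_ne_zero_of_mod_four_eq_one hp
  have hs : 2⁻¹ * (1 + c) ≠ 0 := by
    refine mul_ne_zero (inv_ne_zero h2) fun h ↦ h2 ?_
    linear_combination (1 - c) * h + hc
  have hsc (i : ZMod p) : 2⁻¹ * c * i ^ 2 + i * m =
      (2⁻¹ * (1 + c) * (i - c * m)) ^ 2 + 2⁻¹ * c * m ^ 2 := by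
    field_simp
    linear_combination (4 * i * m - (c * m ^ 2) * (2 + c) - i ^ 2 + 2 * c * i * m) * hc
  simp_rw [hsc, AddChar.map_add_eq_mul]
  rw [← Finset.sum_mul, ← sum_stdAddChar_sq hp]
  congr 1
  exact ((Equiv.subRight (c * m)).trans (Equiv.mulLeft₀ _ hs)).sum_comp
    fun i ↦ stdAddChar (i ^ 2)

theorem ZMod.sum_Icc_natCast {p : ℕ} [Fact p.Prime] {M : Type*} [AddCommMonoid M]
    (g : ZMod p → M) :
    ∑ j ∈ Finset.Icc 1 (p - 1), g (j : ZMod p) = ∑ j with j ≠ 0, g j := by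
  have hp := (Fact.out : p.Prime).pos
  refine Finset.sum_bij' (fun j _ ↦ (j : ZMod p)) (fun j _ ↦ j.val) ?_ ?_ ?_ ?_ ?_
  · intro j hj
    rw [Finset.mem_Icc] at hj
    rw [Finset.mem_filter_univ, Ne, ZMod.natCast_eq_zero_iff]
    exact Nat.not_dvd_of_pos_of_lt (by omega) (by omega)
  · intro j hj
    rw [Finset.mem_filter_univ] at hj
    have := ZMod.val_lt j
    have := (ZMod.val_ne_zero j).2 hj
    rw [Finset.mem_Icc]
    omega
  · intro j hj
    rw [Finset.mem_Icc] at hj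
    exact ZMod.val_cast_of_lt (by omega)
  · intro j _
    exact ZMod.natCast_zmod_val j
  · intro j _
    rfl

/-- For 0 ≤ x ≤ p−1, φ_x is an eigenvector of the DFT with
eigenvalue (−i)^x: F φ_x = (−i)^x · φ_x. -/
theorem phi_eigenvalue_neg_I_pow (p : ℕ) [Fact p.Prime] (hp4 : p % 4 = 1)
    (a : ZMod p) (ha : orderOf a = p - 1)
    (log : ZMod p → ℕ)
    (hlog : ∀ j : ZMod p, j ≠ 0 → log j ≤ p - 2 ∧ a ^ log j = j)
    (θ η : ℂ)
    (hθ : θ = Complex.exp (2 * Real.pi * Complex.I / ((p : ℂ) - 1)))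
    (hη : η = Complex.exp (2 * Real.pi * Complex.I / (p : ℂ)))
    (k : ℕ) (hk : k = (p - 1) / 4)
    (F : EuclideanSpace ℂ (ZMod p) → EuclideanSpace ℂ (ZMod p))
    (hF : ∀ φ : EuclideanSpace ℂ (ZMod p), ∀ j : ZMod p,
      F φ j = (1 / Real.sqrt p : ℂ) * ∑ i : ZMod p, η ^ (i * j).val * φ i)
    (φ : Fin p → EuclideanSpace ℂ (ZMod p))
    (hφ0 : ∀ i : ZMod p,
      φ 0 i = (1 / Real.sqrt p : ℂ) * η ^ (2⁻¹ * a ^ k * i ^ 2).val)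
    (hφx : ∀ x : Fin p, x ≠ 0 → ∀ i : ZMod p,
      φ x i = (1 / Real.sqrt ((p : ℝ) * ((p : ℝ) - 1)) : ℂ) *
        ∑ j ∈ Finset.Icc 1 (p - 1),
          θ ^ ((x : ℕ) * log (j : ZMod p)) *
          η ^ (a ^ k * ((j : ZMod p) - i) ^ 2 - 2⁻¹ * a ^ k * i ^ 2).val) :
    ∀ x : Fin p, F (φ x) = (-Complex.I) ^ (x : ℕ) • φ x := by
  have hp := (Fact.out : p.Prime)
  have hk4 : p - 1 = 4 * k := by omega
  have hk0 : 0 < k := by have := hp.two_le; omega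
  have hpC : (p : ℂ) - 1 = 4 * k := by
    rw [← Nat.cast_one, ← Nat.cast_sub hp.one_le, hk4]
    push_cast
    rfl
  have he (z : ZMod p) : η ^ z.val = ZMod.stdAddChar z := by
    rw [ZMod.stdAddChar_apply, ZMod.toCircle_apply, hη, ← Complex.exp_nat_mul]
    congr 1
    ring
  have hθk : θ ^ k = Complex.I := by
    rw [hθ, ← Complex.exp_nat_mul, hpC]
    have : (k : ℂ) ≠ 0 := Nat.cast_ne_zero.2 hk0.ne'
    have h : k * (2 * Real.pi * Complex.I / (4 * k)) = Real.pi / 2 * Complex.I := by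
      field_simp
      ring
    rw [h, Complex.exp_pi_div_two_mul_I]
  have hθ3k : θ ^ (3 * k) = -Complex.I := by
    rw [mul_comm, pow_mul, hθk, Complex.I_pow_three]
  have hθ1 : θ ^ (p - 1) = 1 := by
    rw [hk4, mul_comm, pow_mul, hθk, Complex.I_pow_four]
  obtain ⟨c, hc⟩ : ∃ c, c = a ^ k := ⟨_, rfl⟩
  have hc2 : c ^ 2 = -1 := by
    have h : (c ^ 2) ^ 2 = 1 := by
      rw [hc, ← pow_mul, ← pow_mul, show k * (2 * 2) = p - 1 by omega, ← ha, pow_orderOf_eq_one]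
    refine (eq_or_eq_neg_of_sq_eq_sq _ 1 (h.trans (one_pow 2).symm)).resolve_left ?_
    rw [hc, ← pow_mul]
    exact pow_ne_one_of_lt_orderOf (by omega) (by omega)
  have hc0 : c ≠ 0 := by
    rintro rfl
    simp at hc2
  have ha_fin : IsOfFinOrder a := orderOf_pos_iff.1 (by omega)
  have hlogc (j : ZMod p) (hj : j ≠ 0) : θ ^ log (-c * j) = -Complex.I * θ ^ log j := by
    have hmod : log (-c * j) ≡ 3 * k + log j [MOD p - 1] := by
      rw [← ha, ← ha_fin.pow_eq_pow_iff_modEq, (hlog _ (mul_ne_zero (neg_ne_zero.2 hc0) hj)).2,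
        pow_add, (hlog j hj).2, mul_comm 3 k, pow_mul, ← hc]
      linear_combination -(c * j) * hc2
    rw [← hθ3k, ← pow_add]
    exact pow_eq_pow_of_modEq hmod hθ1
  have hu : (2 : ZMod p) * 2⁻¹ = 1 :=
    mul_inv_cancel₀ (ZMod.two_ne_zero_of_mod_four_eq_one hp4)
  have hsqrt : (Real.sqrt p : ℂ) ≠ 0 :=
    Complex.ofReal_ne_zero.2 (Real.sqrt_pos.2 (Nat.cast_pos.2 hp.pos)).ne'
  intro x
  ext m
  rw [hF, PiLp.smul_apply, smul_eq_mul]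
  simp_rw [he]
  rcases eq_or_ne x 0 with rfl | hx
  · have hchirp := ZMod.sum_stdAddChar_chirp hp4 hc2 m
    simp_rw [hφ0, he, ← hc]
    simp_rw [mul_left_comm _ (1 / (Real.sqrt p : ℂ)), ← AddChar.map_add_eq_mul,
      add_comm (_ * m)]
    rw [← Finset.mul_sum, hchirp, Fin.val_zero, pow_zero]
    field_simp
  · obtain ⟨g, hg⟩ : ∃ g : ZMod p → ZMod p → ℂ, ∀ i j, g i j = θ ^ ((x : ℕ) * log j) *
      ZMod.stdAddChar (c * (j - i) ^ 2 - 2⁻¹ * c * i ^ 2) := ⟨_, fun _ _ ↦ rfl⟩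
    simp_rw [hφx x hx, he, ← hc, ← hg, ZMod.sum_Icc_natCast (g _)]
    have hinner (j : ZMod p) : ∑ i : ZMod p, ZMod.stdAddChar (i * m) * g i j =
        Real.sqrt p * (θ ^ ((x : ℕ) * log j) *
          ZMod.stdAddChar (2⁻¹ * c * (m - 2 * c * j) ^ 2 + c * j ^ 2)) := by
      rw [AddChar.map_add_eq_mul, mul_left_comm, ← mul_assoc (Real.sqrt p : ℂ),
        ← ZMod.sum_stdAddChar_chirp hp4 hc2, Finset.sum_mul, Finset.mul_sum]
      refine Finset.sum_congr rfl fun i _ ↦ ?_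
      rw [hg, mul_left_comm, ← AddChar.map_add_eq_mul, ← AddChar.map_add_eq_mul]
      congr 2
      linear_combination -(i ^ 2 * c) * hu
    have hreindex : ∑ j with j ≠ 0, θ ^ ((x : ℕ) * log j) *
          ZMod.stdAddChar (2⁻¹ * c * (m - 2 * c * j) ^ 2 + c * j ^ 2) =
        (-Complex.I) ^ (x : ℕ) * ∑ j with j ≠ 0, g m j := by
      rw [Finset.mul_sum]
      symm
      refine Finset.sum_equiv (Equiv.mulLeft₀ (-c) (neg_ne_zero.2 hc0)) (by simp [hc0]) ?_
      intro j hj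
      rw [Finset.mem_filter_univ] at hj
      change _ = θ ^ ((x : ℕ) * log (-c * j)) * ZMod.stdAddChar
        (2⁻¹ * c * (m - 2 * c * (-c * j)) ^ 2 + c * (-c * j) ^ 2)
      have harg : c * (j - m) ^ 2 - 2⁻¹ * c * m ^ 2 =
          2⁻¹ * c * (m - 2 * c * (-c * j)) ^ 2 + c * (-c * j) ^ 2 := by
        linear_combination (-(c * m ^ 2) + 2 * c * m * j - 2 * c * j ^ 2) * hu -
          (2⁻¹ * c * (2 * j) * (2 * m + 2 * c ^ 2 * j - 2 * j) + c * j ^ 2) * hc2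
      rw [hg, harg, mul_comm (x : ℕ) (log (-c * j)), pow_mul θ (log (-c * j)),
        hlogc j hj, mul_pow (-Complex.I), ← pow_mul, mul_comm (log j),
        mul_assoc ((-Complex.I) ^ (x : ℕ))]
    have hswap : ∑ i : ZMod p, ZMod.stdAddChar (i * m) * ∑ j with j ≠ 0, g i j =
        Real.sqrt p * ((-Complex.I) ^ (x : ℕ) * ∑ j with j ≠ 0, g m j) := by
      simp_rw [Finset.mul_sum (s := Finset.univ.filter _) (f := g _)]
      rw [Finset.sum_comm]
      simp_rw [hinner]
      rw [← Finset.mul_sum, hreindex, ← Finset.mul_sum]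
    simp_rw [mul_left_comm _ (1 / (Real.sqrt ((p : ℝ) * ((p : ℝ) - 1)) : ℂ))]
    rw [← Finset.mul_sum, hswap]
    field_simp
end

section
/- The vector φ_0 is a fixed point of the discrete Fourier transform: F φ_0 = φ_0; equivalently, for every t ∈ F_p, (1/p)·∑_{i∈F_p} η^{2⁻¹ a^k i² + i t} = (1/√p)·η^{2⁻¹ a^k t²}. -/
open Finset

/-- The Gaussian binomial coefficient `[n choose j]_q`, in product form. -/
noncomputable def gaussBinom {K : Type*} [Field K] (q : K) (n j : ℕ) : K :=
  ∏ i ∈ range j, (1 - q ^ (n - i)) / (1 - q ^ (i + 1))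

section GaussBinom

variable {K : Type*} [Field K] {q : K}

lemma gaussBinom_zero_right (n : ℕ) : gaussBinom q n 0 = 1 := by
  simp [gaussBinom]

lemma gaussBinom_self_succ (n : ℕ) : gaussBinom q n (n + 1) = 0 := by
  simp [gaussBinom, prod_range_succ]

lemma gaussBinom_succ_right_mul (n j : ℕ) (h : q ^ (j + 1) ≠ 1) :
    gaussBinom q n (j + 1) * (1 - q ^ (j + 1)) = gaussBinom q n j * (1 - q ^ (n - j)) := by
  have h' : 1 - q ^ (j + 1) ≠ 0 := sub_ne_zero.2 h.symm
  rw [gaussBinom, prod_range_succ, ← gaussBinom]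
  field_simp

lemma gaussBinom_succ_left_mul (n j : ℕ) (h : ∀ i < j, q ^ (i + 1) ≠ 1) :
    gaussBinom q (n + 1) j * (1 - q ^ (n + 1 - j)) = (1 - q ^ (n + 1)) * gaussBinom q n j := by
  induction j with
  | zero => simp [gaussBinom_zero_right]
  | succ j ih =>
    have hj := h j j.lt_succ_self
    have ih := ih fun i hi => h i (hi.trans j.lt_succ_self)
    have h1 := gaussBinom_succ_right_mul (n + 1) j hj
    have h2 := gaussBinom_succ_right_mul n j hj
    refine mul_right_cancel₀ (sub_ne_zero.2 hj.symm) ?_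
    rw [Nat.add_sub_add_right]
    linear_combination (1 - q ^ (n - j)) * h1 + (1 - q ^ (n - j)) * ih - (1 - q ^ (n + 1)) * h2

lemma gaussBinom_succ_succ (n j : ℕ) (hjn : j ≤ n) (h : ∀ i ≤ j, q ^ (i + 1) ≠ 1) :
    gaussBinom q (n + 1) (j + 1) = gaussBinom q n (j + 1) + q ^ (n - j) * gaussBinom q n j := by
  have hj := h j le_rfl
  refine mul_right_cancel₀ (sub_ne_zero.2 hj.symm) ?_
  have h1 := gaussBinom_succ_right_mul (n + 1) j hj
  have h2 := gaussBinom_succ_right_mul n j hj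
  have h3 := gaussBinom_succ_left_mul n j fun i hi => h i hi.le
  have h4 : q ^ (n - j) * q ^ (j + 1) = q ^ (n + 1) := by
    rw [← pow_add]; congr 1; omega
  linear_combination h1 + h3 - h2 + gaussBinom q n j * h4

lemma sum_neg_one_pow_mul_gaussBinom_add_two (n : ℕ) (h : ∀ i < n + 2, q ^ (i + 1) ≠ 1) :
    ∑ j ∈ range (n + 3), (-1) ^ j * gaussBinom q (n + 2) j =
      (1 - q ^ (n + 1)) * ∑ j ∈ range (n + 1), (-1) ^ j * gaussBinom q n j := by
  have h1 : ∑ j ∈ range (n + 3), (-1) ^ j * gaussBinom q (n + 1) j =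
      ∑ j ∈ range (n + 2), (-1) ^ j * gaussBinom q (n + 1) j := by
    rw [sum_range_succ, gaussBinom_self_succ, mul_zero, add_zero]
  have h2 : ∑ j ∈ range (n + 2), (-1) ^ j * gaussBinom q n j =
      ∑ j ∈ range (n + 1), (-1) ^ j * gaussBinom q n j := by
    rw [sum_range_succ, gaussBinom_self_succ, mul_zero, add_zero]
  rw [sum_range_succ', gaussBinom_zero_right] at h1 ⊢
  rw [← h2, mul_sum]
  calc _ = ∑ j ∈ range (n + 2), ((-1) ^ (j + 1) * gaussBinom q (n + 1) (j + 1) +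
          (-1) ^ (j + 1) * (q ^ (n + 1 - j) * gaussBinom q (n + 1) j)) + (-1) ^ 0 * 1 := by
        congr 1
        refine sum_congr rfl fun j hj => ?_
        have hj := mem_range.1 hj
        rw [gaussBinom_succ_succ (n + 1) j (by omega) fun i hi => h i (by omega), mul_add]
    _ = ∑ j ∈ range (n + 2), ((-1) ^ j * gaussBinom q (n + 1) j +
          (-1) ^ (j + 1) * (q ^ (n + 1 - j) * gaussBinom q (n + 1) j)) := by
        rw [sum_add_distrib, sum_add_distrib, ← h1]; ring
    _ = _ := by
        refine sum_congr rfl fun j hj => ?_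
        have hj := mem_range.1 hj
        have := gaussBinom_succ_left_mul n j fun i hi => h i (by omega)
        linear_combination (-1) ^ j * this

/-- Gauss's product formula for the alternating sum of Gaussian binomial coefficients. -/
lemma sum_neg_one_pow_mul_gaussBinom (m : ℕ) (h : ∀ i < 2 * m, q ^ (i + 1) ≠ 1) :
    ∑ j ∈ range (2 * m + 1), (-1) ^ j * gaussBinom q (2 * m) j =
      ∏ i ∈ range m, (1 - q ^ (2 * i + 1)) := by
  induction m with
  | zero => simp [gaussBinom_zero_right]
  | succ m ih =>
    rw [prod_range_succ, ← ih fun i hi => h i (by omega), mul_comm _ (1 - q ^ _)]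
    rw [show 2 * (m + 1) = 2 * m + 2 by ring] at h ⊢
    exact sum_neg_one_pow_mul_gaussBinom_add_two (2 * m) h

lemma gaussBinom_of_pow_eq_one (N j : ℕ) (hN : q ^ (N + 1) = 1) (hj : j ≤ N)
    (h : ∀ i < N, q ^ (i + 1) ≠ 1) :
    gaussBinom q N j = (-1) ^ j * ∏ i ∈ range j, (q⁻¹) ^ (i + 1) := by
  have hq : q ≠ 0 := by rintro rfl; simp at hN
  rw [gaussBinom, ← card_range j, ← prod_const, card_range, ← prod_mul_distrib]
  refine prod_congr rfl fun i hi => ?_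
  have hi := mem_range.1 hi
  have h1 : 1 - q ^ (i + 1) ≠ 0 := sub_ne_zero.2 (h i (by omega)).symm
  have h2 : q ^ (N - i) * q ^ (i + 1) = 1 := by
    rw [← pow_add, ← hN]; congr 1; omega
  rw [inv_pow, eq_inv_of_mul_eq_one_left h2]
  field_simp
  ring

end GaussBinom

lemma sum_pow_mul_succ_eq_prod {K : Type*} [Field K] {ζ : K} {m : ℕ}
    (hζ : IsPrimitiveRoot ζ (2 * m + 1)) :
    ∑ j ∈ range (2 * m + 1), ζ ^ (j * (j + 1)) =
      ∏ i ∈ range m, (1 - (ζ⁻¹) ^ (2 * (2 * i + 1))) := by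
  have hq : IsPrimitiveRoot ((ζ⁻¹) ^ 2) (2 * m + 1) :=
    hζ.inv.pow_of_coprime 2 (by simp)
  have h : ∀ i < 2 * m, ((ζ⁻¹) ^ 2) ^ (i + 1) ≠ 1 := fun i hi =>
    hq.pow_ne_one_of_pos_of_lt (by omega) (by omega)
  simp_rw [pow_mul]
  simp_rw [← pow_mul ζ]
  rw [← sum_neg_one_pow_mul_gaussBinom m h]
  refine sum_congr rfl fun j hj => ?_
  rw [gaussBinom_of_pow_eq_one (2 * m) j hq.pow_eq_one (by have := mem_range.1 hj; omega) h,
    ← mul_assoc, ← mul_pow]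
  simp only [inv_pow, inv_inv, mul_neg, mul_one, neg_neg, one_pow, one_mul]
  simp_rw [← pow_mul]
  have h2 := sum_range_id_mul_two (j + 1)
  rw [sum_range_succ', add_zero, Nat.add_sub_cancel] at h2
  rw [prod_pow_eq_pow_sum, ← mul_sum, mul_comm 2, h2, mul_comm]

lemma sum_range_eq_sum_zmod {M : Type*} [AddCommMonoid M] (n : ℕ) [NeZero n] (f : ZMod n → M) :
    ∑ j ∈ range n, f j = ∑ x, f x :=
  sum_nbij' (fun j => (j : ZMod n)) ZMod.val (by simp) (by simp [ZMod.val_lt])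
    (fun j hj => ZMod.val_cast_of_lt (mem_range.1 hj)) (by simp) (by simp)

lemma stdAddChar_natCast (N : ℕ) [NeZero N] (j : ℕ) :
    ZMod.stdAddChar (j : ZMod N) = Complex.exp (2 * Real.pi * Complex.I / N) ^ j := by
  rw [← Int.cast_natCast (R := ZMod N), ZMod.stdAddChar_coe, ← Complex.exp_nat_mul]
  congr 1
  push_cast
  ring

lemma sum_stdAddChar_sq_eq_prod (p m : ℕ) [NeZero p] (hp : p = 2 * m + 1) :
    ∑ x : ZMod p, ZMod.stdAddChar (x ^ 2) =
      ∏ i ∈ range m, (2 * Complex.I * Real.sin (2 * Real.pi * (2 * i + 1) / p)) := by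
  set ζ := Complex.exp (2 * Real.pi * Complex.I / p) with hζ
  have hprim : IsPrimitiveRoot ζ (2 * m + 1) := hp ▸ Complex.isPrimitiveRoot_exp p (NeZero.ne p)
  have hm : 2 * (m : ZMod p) + 1 = 0 := by
    have := ZMod.natCast_self p
    conv at this => enter [1, 1]; rw [hp]
    exact_mod_cast this
  have hodd : ∏ i ∈ range m, ζ ^ (2 * i + 1) = ζ ^ (m ^ 2) := by
    rw [prod_pow_eq_pow_sum]
    congr 1
    clear * -
    induction m with
    | zero => simp
    | succ m ih => rw [sum_range_succ, ih]; ring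
  calc ∑ x : ZMod p, ZMod.stdAddChar (x ^ 2)
      = ∑ x : ZMod p, ZMod.stdAddChar ((x + ((m : ZMod p) + 1)) ^ 2) := by
        rw [← Equiv.sum_comp (Equiv.addRight ((m : ZMod p) + 1))]
        simp only [Equiv.coe_addRight]
    _ = ∑ j ∈ range p, ZMod.stdAddChar (((j : ZMod p) + ((m : ZMod p) + 1)) ^ 2) :=
        (sum_range_eq_sum_zmod p fun x => ZMod.stdAddChar ((x + ((m : ZMod p) + 1)) ^ 2)).symm
    _ = ∑ j ∈ range p, ζ ^ (m ^ 2) * ζ ^ (j * (j + 1)) := by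
        refine sum_congr rfl fun j _ => ?_
        rw [← pow_add, ← stdAddChar_natCast]
        congr 1
        push_cast
        linear_combination (j + 1) * hm
    _ = ∏ i ∈ range m, (ζ ^ (2 * i + 1) * (1 - (ζ⁻¹) ^ (2 * (2 * i + 1)))) := by
        rw [← mul_sum, prod_mul_distrib, hodd, ← sum_pow_mul_succ_eq_prod hprim, hp]
    _ = _ := by
        refine prod_congr rfl fun i _ => ?_
        have h1 : ζ ^ (2 * i + 1) =
            Complex.exp ((2 * Real.pi * (2 * i + 1) / p : ℝ) * Complex.I) := by
          rw [hζ, ← Complex.exp_nat_mul]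
          congr 1
          push_cast
          ring
        rw [mul_comm 2 (2 * i + 1), pow_mul, inv_pow, h1, ← Complex.exp_neg, Complex.ofReal_sin,
          Complex.sin, neg_mul]
        set w := ((2 * Real.pi * (2 * i + 1) / p : ℝ) : ℂ) * Complex.I
        have hw : Complex.exp w * Complex.exp (-w) = 1 := by rw [← Complex.exp_add]; simp
        linear_combination (-Complex.exp (-w)) * hw -
          (Complex.exp (-w) - Complex.exp w) * Complex.I_sq

lemma sum_stdAddChar_sq_eq_ofReal_pos (p : ℕ) [NeZero p] (hp : p % 4 = 1) :
    ∃ r : ℝ, 0 < r ∧ ∑ x : ZMod p, ZMod.stdAddChar (x ^ 2) = (r : ℂ) := by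
  obtain ⟨n, hn⟩ : ∃ n, p = 2 * (n + n) + 1 := ⟨p / 4, by omega⟩
  have hpR : (p : ℝ) = 4 * n + 1 := by rw [hn]; push_cast; ring
  have hp0 : (0 : ℝ) < p := by rw [hpR]; positivity
  have hpi := Real.pi_pos
  refine ⟨∏ i ∈ range n, (4 * Real.sin (2 * Real.pi * (2 * i + 1) / p) *
      -Real.sin (2 * Real.pi * (2 * (n + i : ℕ) + 1) / p)), ?_, ?_⟩
  · refine prod_pos fun i hi => ?_
    have hi : (i : ℝ) + 1 ≤ n := by exact_mod_cast mem_range.1 hi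
    have hi0 : (0 : ℝ) ≤ i := i.cast_nonneg
    have h1 : 0 < Real.sin (2 * Real.pi * (2 * i + 1) / p) := by
      refine Real.sin_pos_of_pos_of_lt_pi (by positivity) ?_
      rw [div_lt_iff₀ hp0, hpR]
      nlinarith
    have h2 : Real.sin (2 * Real.pi * (2 * (n + i : ℕ) + 1) / p) < 0 := by
      rw [← Real.sin_sub_two_pi]
      refine Real.sin_neg_of_neg_of_neg_pi_lt ?_ ?_
      · rw [sub_neg, div_lt_iff₀ hp0, hpR]
        push_cast
        nlinarith
      · rw [neg_lt_sub_iff_lt_add, ← sub_lt_iff_lt_add', lt_div_iff₀ hp0, hpR]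
        push_cast
        nlinarith
    have := neg_pos.2 h2
    positivity
  · rw [sum_stdAddChar_sq_eq_prod p (n + n) hn, prod_range_add, ← prod_mul_distrib,
      Complex.ofReal_prod]
    refine prod_congr rfl fun i _ => ?_
    rw [Complex.ofReal_mul, Complex.ofReal_mul, Complex.ofReal_neg]
    push_cast
    linear_combination 4 * Complex.sin (2 * Real.pi * (2 * i + 1) / p) *
      Complex.sin (2 * Real.pi * (2 * (n + i) + 1) / p) * Complex.I_sq

lemma sum_stdAddChar_sq_mul_sum_neg_sq (p : ℕ) [NeZero p] (hp : Odd p) :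
    (∑ x : ZMod p, ZMod.stdAddChar (x ^ 2)) * ∑ y : ZMod p, ZMod.stdAddChar (-y ^ 2) = p := by
  have h2 : IsUnit (2 : ZMod p) := by
    exact_mod_cast (ZMod.isUnit_iff_coprime 2 p).2 (Nat.coprime_two_left.2 hp)
  calc _ = ∑ y : ZMod p, ∑ x : ZMod p, ZMod.stdAddChar (x ^ 2 - y ^ 2) := by
        rw [sum_mul_sum, sum_comm]
        simp_rw [sub_eq_add_neg, AddChar.map_add_eq_mul]
    _ = ∑ y : ZMod p, ∑ u : ZMod p, ZMod.stdAddChar (u ^ 2) * ZMod.stdAddChar (y * (2 * u)) := by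
        refine sum_congr rfl fun y _ => ?_
        rw [← Equiv.sum_comp (Equiv.addRight y)]
        refine sum_congr rfl fun u _ => ?_
        rw [← AddChar.map_add_eq_mul]
        congr 1
        simp only [Equiv.coe_addRight]
        ring
    _ = p := by
        rw [sum_comm]
        simp_rw [← mul_sum, AddChar.sum_mulShift _ (ZMod.isPrimitive_stdAddChar p),
          h2.mul_right_eq_zero]
        simp

/-- The quadratic Gauss sum for a prime `p ≡ 1 (mod 4)`, including its sign. -/
lemma sum_stdAddChar_sq (p : ℕ) [Fact p.Prime] (hp : p % 4 = 1) :
    ∑ x : ZMod p, ZMod.stdAddChar (x ^ 2) = (Real.sqrt p : ℂ) := by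
  obtain ⟨r, hr, h⟩ := sum_stdAddChar_sq_eq_ofReal_pos p hp
  obtain ⟨b, hb⟩ := ZMod.exists_sq_eq_neg_one_iff.2 (show p % 4 ≠ 3 by omega)
  have hb0 : b ≠ 0 := by rintro rfl; simp at hb
  have hneg : ∑ y : ZMod p, ZMod.stdAddChar (-y ^ 2) = ∑ x : ZMod p, ZMod.stdAddChar (x ^ 2) := by
    rw [← Equiv.sum_comp (Equiv.mulLeft₀ b hb0) fun x => ZMod.stdAddChar (x ^ 2)]
    refine sum_congr rfl fun y _ => ?_
    congr 1
    simp only [Equiv.mulLeft₀_apply]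
    linear_combination y ^ 2 * hb
  have hmul := sum_stdAddChar_sq_mul_sum_neg_sq p (Nat.odd_iff.2 (by omega))
  rw [hneg, h] at hmul
  have hr2 : r * r = p := by exact_mod_cast hmul
  rw [h, ← hr2, Real.sqrt_mul_self hr.le]

lemma sum_stdAddChar_quadratic (p : ℕ) [Fact p.Prime] (hp : p % 4 = 1) (b : ZMod p)
    (hb : b ^ 2 = -1) (t : ZMod p) :
    ∑ i : ZMod p, ZMod.stdAddChar (2⁻¹ * b * i ^ 2 + i * t) =
      Real.sqrt p * ZMod.stdAddChar (2⁻¹ * b * t ^ 2) := by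
  have h2 : (2 : ZMod p) ≠ 0 := by
    have : Fact (2 < p) := ⟨by have := (Fact.out : p.Prime).two_le; omega⟩
    exact Ring.two_ne_zero (by rw [ZMod.ringChar_zmod_n]; omega)
  have h22 : (2 : ZMod p) * 2⁻¹ = 1 := mul_inv_cancel₀ h2
  have hc : (2⁻¹ * (1 + b) : ZMod p) ≠ 0 := by
    refine mul_ne_zero (inv_ne_zero h2) fun h => h2 ?_
    linear_combination (1 - b) * h + hb
  rw [← sum_stdAddChar_sq p hp, sum_mul,
    ← Equiv.sum_comp ((Equiv.subRight (b * t)).trans (Equiv.mulLeft₀ _ hc))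
      fun x => ZMod.stdAddChar (x ^ 2) * ZMod.stdAddChar (2⁻¹ * b * t ^ 2)]
  refine sum_congr rfl fun i _ => ?_
  rw [← AddChar.map_add_eq_mul]
  congr 1
  simp only [Equiv.trans_apply, Equiv.subRight_apply, Equiv.mulLeft₀_apply]
  linear_combination -(2⁻¹ ^ 2 * (i - b * t) ^ 2 - 2 * 2⁻¹ * i * t + 2⁻¹ * b * t ^ 2) * hb -
    (2⁻¹ * b * (i - b * t) ^ 2 + i * t) * h22

/-- φ_0 is a fixed point of the DFT: F φ_0 = φ_0; equivalently,
for every t, (1/p)·∑_i η^{2⁻¹ a^k i² + i t} = (1/√p)·η^{2⁻¹ a^k t²}. -/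
theorem phi_zero_fixed_by_dft (p : ℕ) [Fact p.Prime] (hp4 : p % 4 = 1)
    (a : ZMod p) (ha : orderOf a = p - 1)
    (η : ℂ) (hη : η = Complex.exp (2 * Real.pi * Complex.I / (p : ℂ)))
    (k : ℕ) (hk : k = (p - 1) / 4)
    (F : (ZMod p → ℂ) → (ZMod p → ℂ))
    (hF : ∀ φ : ZMod p → ℂ, ∀ j : ZMod p,
      F φ j = (1 / Real.sqrt p : ℂ) * ∑ i : ZMod p, η ^ (i * j).val * φ i)
    (φ₀ : ZMod p → ℂ)
    (hφ0 : ∀ i : ZMod p,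
      φ₀ i = (1 / Real.sqrt p : ℂ) * η ^ (2⁻¹ * a ^ k * i ^ 2).val) :
    F φ₀ = φ₀ ∧
    ∀ t : ZMod p,
      (1 / (p : ℂ)) * ∑ i : ZMod p, η ^ (2⁻¹ * a ^ k * i ^ 2 + i * t).val =
        (1 / Real.sqrt p : ℂ) * η ^ (2⁻¹ * a ^ k * t ^ 2).val := by
  have hp2 := (Fact.out : p.Prime).two_le
  have hpow (z : ZMod p) : η ^ z.val = ZMod.stdAddChar z := by
    rw [hη, ← stdAddChar_natCast, ZMod.natCast_zmod_val]
  have hb : (a ^ k) ^ 2 = -1 := by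
    have h1 : ((a ^ k) ^ 2) ^ 2 = 1 := by
      rw [← pow_mul, ← pow_mul, ← orderOf_dvd_iff_pow_eq_one, ha]
      exact ⟨1, by omega⟩
    refine (sq_eq_one_iff.1 h1).resolve_left ?_
    rw [← pow_mul]
    exact pow_ne_one_of_lt_orderOf (by omega) (by omega)
  have hp0 : (Real.sqrt p : ℂ) ≠ 0 := by
    rw [Complex.ofReal_ne_zero]
    exact (Real.sqrt_pos.2 (by positivity)).ne'
  have hsq : (Real.sqrt p : ℂ) * Real.sqrt p = p := by
    rw [← Complex.ofReal_mul, Real.mul_self_sqrt p.cast_nonneg, Complex.ofReal_natCast]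
  have key (t : ZMod p) :
      (1 / (p : ℂ)) * ∑ i : ZMod p, η ^ (2⁻¹ * a ^ k * i ^ 2 + i * t).val =
        (1 / Real.sqrt p : ℂ) * η ^ (2⁻¹ * a ^ k * t ^ 2).val := by
    simp_rw [hpow]
    rw [sum_stdAddChar_quadratic p hp4 _ hb, ← hsq]
    field_simp
  refine ⟨funext fun t => ?_, key⟩
  rw [hF, hφ0, ← key, ← hsq, mul_sum, mul_sum]
  refine sum_congr rfl fun i _ => ?_
  rw [hφ0, hpow, hpow, hpow, AddChar.map_add_eq_mul]
  field_simp
end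

section
/- Write p = 4m+1. The discrete Fourier transform F on ℂ(F_p) is diagonalizable with eigenvalues among {1, −1, i, −i}, and the dimensions of its eigenspaces are: m+1 for eigenvalue 1, and m for each of the eigenvalues −1, i, and −i. -/
open Finset in
theorem Module.End.exists_basis_toMatrix_eq_diagonal {K V : Type*} [Field K] [DecidableEq K]
    [AddCommGroup V] [Module K V] [FiniteDimensional K V] (f : Module.End K V) (s : Finset K)
    (hs : ⨆ μ ∈ s, f.eigenspace μ = ⊤) :
    ∃ b : Module.Basis (Σ μ : s, Fin (Module.finrank K (f.eigenspace μ))) K V,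
      LinearMap.toMatrix b b f = Matrix.diagonal fun i => (i.1 : K) := by
  have hint : DirectSum.IsInternal fun μ : s => f.eigenspace (μ : K) := by
    apply DirectSum.isInternal_submodule_of_iSupIndep_of_iSup_eq_top
    · exact f.eigenspaces_iSupIndep.comp Subtype.val_injective
    · rw [← hs, iSup_subtype]
  refine ⟨hint.collectedBasis fun μ => Module.finBasis K (f.eigenspace (μ : K)), ?_⟩
  ext i j
  rw [LinearMap.toMatrix_apply,
    Module.End.mem_eigenspace_iff.mp (hint.collectedBasis_mem _ j), map_smul, Module.Basis.repr_self,
    Matrix.diagonal_apply]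
  by_cases h : i = j
  · subst h; simp
  · simp [h]

theorem Module.End.trace_pow_eq_sum_finrank_eigenspace {K V : Type*} [Field K] [DecidableEq K]
    [AddCommGroup V] [Module K V] [FiniteDimensional K V] (f : Module.End K V) (s : Finset K)
    (hs : ⨆ μ ∈ s, f.eigenspace μ = ⊤) (k : ℕ) :
    LinearMap.trace K V (f ^ k) = ∑ μ ∈ s, (Module.finrank K (f.eigenspace μ) : K) * μ ^ k := by
  obtain ⟨b, hb⟩ := f.exists_basis_toMatrix_eq_diagonal s hs
  rw [LinearMap.trace_eq_matrix_trace K b, ← LinearMap.toMatrix_pow, hb, Matrix.diagonal_pow,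
    Matrix.trace_diagonal, Fintype.sum_sigma, ← Finset.sum_coe_sort s]
  simp

theorem Module.End.det_eq_prod_pow_finrank_eigenspace {K V : Type*} [Field K] [DecidableEq K]
    [AddCommGroup V] [Module K V] [FiniteDimensional K V] (f : Module.End K V) (s : Finset K)
    (hs : ⨆ μ ∈ s, f.eigenspace μ = ⊤) :
    LinearMap.det f = ∏ μ ∈ s, μ ^ Module.finrank K (f.eigenspace μ) := by
  obtain ⟨b, hb⟩ := f.exists_basis_toMatrix_eq_diagonal s hs
  rw [← LinearMap.det_toMatrix b, hb, Matrix.det_diagonal, Fintype.prod_sigma,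
    ← Finset.prod_coe_sort s]
  simp

theorem Module.End.iSup_eigenspace_eq_top_of_pow_four_eq_one {V : Type*} [AddCommGroup V]
    [Module ℂ V] (f : Module.End ℂ V) (hf : ∀ v, f (f (f (f v))) = v) :
    ⨆ μ ∈ ({1, -1, Complex.I, -Complex.I} : Set ℂ), f.eigenspace μ = ⊤ := by
  rw [eq_top_iff]
  rintro v -
  have key (μ : ℂ) (hμ : μ ∈ ({1, -1, Complex.I, -Complex.I} : Set ℂ)) :
      (4⁻¹ : ℂ) • (v + μ ^ 3 • f v + μ ^ 2 • f (f v) + μ • f (f (f v))) ∈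
        ⨆ μ ∈ ({1, -1, Complex.I, -Complex.I} : Set ℂ), f.eigenspace μ := by
    refine Submodule.mem_iSup_of_mem μ (Submodule.mem_iSup_of_mem hμ ?_)
    have h4 : μ ^ 4 = 1 := by
      rcases hμ with rfl | rfl | rfl | rfl <;> simp [Even.neg_pow (show Even 4 by decide)]
    rw [Module.End.mem_eigenspace_iff]
    simp only [map_smul, map_add, hf]
    linear_combination (norm := module) (-(4⁻¹ : ℂ) • h4) • f v
  have hsum := add_mem (add_mem (key 1 (by simp)) (key (-1) (by simp)))
    (add_mem (key Complex.I (by simp)) (key (-Complex.I) (by simp)))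
  convert hsum using 1
  have h3 : Complex.I ^ 3 = -Complex.I := Complex.I_pow_three
  simp only [Odd.neg_pow (show Odd 3 by decide), neg_sq, h3, Complex.I_sq]
  module

theorem LinearMap.trace_pi_eq_sum {R n : Type*} [CommRing R] [Fintype n] [DecidableEq n]
    (f : (n → R) →ₗ[R] (n → R)) :
    LinearMap.trace R (n → R) f = ∑ i, f (Pi.single i 1) i := by
  rw [LinearMap.trace_eq_matrix_trace R (Pi.basisFun R n), Matrix.trace]
  simp

theorem AddChar.normSq_sum_sq {R : Type*} [Field R] [Fintype R] [DecidableEq R]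
    (h2 : (2 : R) ≠ 0) {ψ : AddChar R ℂ} (hψ : ψ.IsPrimitive) :
    Complex.normSq (∑ x, ψ (x * x)) = Fintype.card R := by
  apply Complex.ofReal_injective
  rw [Complex.normSq_eq_conj_mul_self, map_sum, Finset.sum_mul_sum]
  simp_rw [← AddChar.map_neg_eq_conj, ← AddChar.map_add_eq_mul]
  calc ∑ y, ∑ x, ψ (-(y * y) + x * x)
      = ∑ y, ∑ t, ψ (t * t) * ψ (y * (2 * t)) := by
        refine Finset.sum_congr rfl fun y _ => ?_
        refine Fintype.sum_equiv (Equiv.subRight y) _ _ fun x => ?_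
        rw [← AddChar.map_add_eq_mul, Equiv.subRight_apply]
        ring_nf
    _ = ∑ t, ψ (t * t) * ∑ y, ψ (y * (2 * t)) := by
        rw [Finset.sum_comm]
        simp_rw [Finset.mul_sum]
    _ = _ := by
        simp_rw [AddChar.sum_mulShift _ hψ]
        simp [h2]

theorem Fin.sum_card_Ioi (n : ℕ) : 2 * ∑ i : Fin n, (Finset.Ioi i).card = n * (n - 1) := by
  simp_rw [Fin.card_Ioi]
  rw [Fin.sum_univ_eq_sum_range (fun i => n - 1 - i), Finset.sum_range_reflect (fun i => i),
    mul_comm, Finset.sum_range_id_mul_two]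

theorem Fin.sum_sum_Ioi_add (n : ℕ) :
    2 * ∑ i : Fin n, ∑ j ∈ Finset.Ioi i, ((i : ℕ) + j) = n * (n - 1) * (n - 1) := by
  have hswap : ∑ i : Fin n, ∑ j ∈ Finset.Ioi i, (j : ℕ) =
      ∑ j : Fin n, ∑ i ∈ Finset.Iio j, (j : ℕ) :=
    Finset.sum_comm' (by simp)
  simp_rw [Finset.sum_add_distrib]
  rw [hswap, ← Finset.sum_add_distrib]
  have (i : Fin n) : ∑ j ∈ Finset.Ioi i, (i : ℕ) + ∑ j ∈ Finset.Iio i, (i : ℕ) = i * (n - 1) := by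
    simp only [Finset.sum_const, Fin.card_Ioi, Fin.card_Iio, smul_eq_mul, ← add_mul]
    rw [mul_comm]
    congr 1
    omega
  simp_rw [this]
  rw [← Finset.sum_mul, Fin.sum_univ_eq_sum_range (fun i => i), ← mul_assoc, mul_comm 2,
    Finset.sum_range_id_mul_two]

open Complex in
theorem Complex.exp_two_mul_I_sub_exp_two_mul_I (x y : ℂ) :
    exp (2 * y * I) - exp (2 * x * I) = exp ((x + y) * I) * I * (2 * sin (y - x)) := by
  have h1 : exp (2 * y * I) = exp ((x + y) * I) * exp ((y - x) * I) := by
    rw [← exp_add]; ring_nf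
  have h2 : exp (2 * x * I) = exp ((x + y) * I) * exp (-(y - x) * I) := by
    rw [← exp_add]; ring_nf
  rw [h1, h2, two_sin]
  linear_combination (exp ((x + y) * I) * (exp (-(y - x) * I) - exp ((y - x) * I))) * (-I_sq)

open Complex in
theorem exists_pos_det_vandermonde_exp (m : ℕ) :
    ∃ r : ℝ, 0 < r ∧
      (Matrix.vandermonde fun i : Fin (4 * m + 1) =>
        exp (2 * Real.pi * I / (4 * m + 1 : ℕ)) ^ (i : ℕ)).det = (-1) ^ m * r := by
  set n := 4 * m + 1 with hn
  have hn0 : (n : ℝ) ≠ 0 := by positivity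
  have hn0' : (n : ℂ) ≠ 0 := by exact_mod_cast hn0
  refine ⟨∏ i : Fin n, ∏ j ∈ Finset.Ioi i, 2 * Real.sin (Real.pi * ((j : ℝ) - i) / n), ?_, ?_⟩
  · refine Finset.prod_pos fun i _ => Finset.prod_pos fun j hj => ?_
    have hij : (i : ℝ) < j := by exact_mod_cast Finset.mem_Ioi.mp hj
    have hjn : (j : ℝ) < n := by exact_mod_cast j.2
    have hi : (0 : ℝ) ≤ i := by positivity
    have hnpos : (0 : ℝ) < n := by positivity
    refine mul_pos two_pos (Real.sin_pos_of_pos_of_lt_pi ?_ ?_)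
    · exact div_pos (mul_pos Real.pi_pos (sub_pos.mpr hij)) hnpos
    · rw [div_lt_iff₀ hnpos]
      exact mul_lt_mul_of_pos_left (by linarith) Real.pi_pos
  · have hfac (i j : Fin n) :
        exp (2 * Real.pi * I / n) ^ (j : ℕ) - exp (2 * Real.pi * I / n) ^ (i : ℕ) =
          exp (Real.pi * I / n) ^ ((i : ℕ) + j) * I *
          ((2 * Real.sin (Real.pi * ((j : ℝ) - i) / n) : ℝ) : ℂ) := by
      have := exp_two_mul_I_sub_exp_two_mul_I (Real.pi * i / n) (Real.pi * j / n)
      rw [← exp_nat_mul, ← exp_nat_mul, ← exp_nat_mul]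
      push_cast
      convert this using 2 <;> ring_nf
    simp_rw [Matrix.det_vandermonde, hfac, ofReal_prod, Finset.prod_mul_distrib,
      Finset.prod_pow_eq_pow_sum, Finset.prod_const, Finset.prod_pow_eq_pow_sum]
    have hcard : ∑ i : Fin n, (Finset.Ioi i).card = 2 * (m * n) := by
      have := Fin.sum_card_Ioi n
      have h4 : n - 1 = 4 * m := by omega
      rw [h4] at this
      linarith
    have hsum : ∑ i : Fin n, ∑ j ∈ Finset.Ioi i, ((i : ℕ) + j) = n * (8 * m ^ 2) := by
      have := Fin.sum_sum_Ioi_add n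
      have h4 : n - 1 = 4 * m := by omega
      rw [h4] at this
      linarith
    have hexp : exp (Real.pi * I / n) ^ n = -1 := by
      rw [← exp_nat_mul, mul_div_cancel₀ _ hn0', exp_pi_mul_I]
    rw [hcard, hsum, pow_mul, hexp, pow_mul I, I_sq, pow_mul (-1) m n]
    have hodd : Odd n := ⟨2 * m, by omega⟩
    have heven : Even (8 * m ^ 2) := ⟨4 * m ^ 2, by ring⟩
    rw [heven.neg_one_pow, ← pow_mul, mul_comm m n, pow_mul, hodd.neg_one_pow, one_mul]

theorem ZMod.exp_pow_val_eq_stdAddChar {N : ℕ} [NeZero N] (x : ZMod N) :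
    Complex.exp (2 * Real.pi * Complex.I / (N : ℂ)) ^ x.val = ZMod.stdAddChar x := by
  have := ZMod.stdAddChar_coe (N := N) (x.val : ℤ)
  rw [Int.cast_natCast, ZMod.natCast_zmod_val] at this
  rw [this, ← Complex.exp_nat_mul]
  push_cast
  ring_nf

open ZMod in
theorem ZMod.apply_apply_of_eq_stdAddChar_sum {N : ℕ} [NeZero N]
    (F : (ZMod N → ℂ) →ₗ[ℂ] (ZMod N → ℂ))
    (hF : ∀ φ j, F φ j = (1 / Real.sqrt N : ℂ) * ∑ i, stdAddChar (i * j) * φ i)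
    (φ : ZMod N → ℂ) : F (F φ) = fun j => φ (-j) := by
  have hF' (φ : ZMod N → ℂ) : F φ = (1 / Real.sqrt N : ℂ) • 𝓕 fun j => φ (-j) := by
    ext j
    rw [hF, dft_comp_neg, Pi.smul_apply, dft_apply]
    simp
  have hN : ((Real.sqrt N : ℝ) : ℂ) * (Real.sqrt N : ℝ) = N := by
    rw [← Complex.ofReal_mul, Real.mul_self_sqrt N.cast_nonneg, Complex.ofReal_natCast]
  have hN0 : (N : ℂ) ≠ 0 := NeZero.ne _
  have hs : ((Real.sqrt N : ℝ) : ℂ) ≠ 0 := fun h => hN0 (by rw [← hN, h, zero_mul])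
  rw [hF' (F φ), hF' φ]
  ext j
  have : (fun k => ((1 / Real.sqrt N : ℂ) • 𝓕 fun j => φ (-j)) (-k)) =
      (1 / Real.sqrt N : ℂ) • 𝓕 φ := by
    ext k
    simp [dft_comp_neg]
  rw [this, dft_const_smul, dft_dft]
  simp only [Pi.smul_apply, smul_eq_mul, ← hN]
  field_simp

theorem exists_pos_det_eq_of_apply_eq_sum (m : ℕ)
    (F : (ZMod (4 * m + 1) → ℂ) →ₗ[ℂ] (ZMod (4 * m + 1) → ℂ))
    (c : ℝ) (hc : 0 < c)
    (hF : ∀ φ j, F φ j = (c : ℂ) * ∑ i, ZMod.stdAddChar (i * j) * φ i) :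
    ∃ r : ℝ, 0 < r ∧ LinearMap.det F = (-1) ^ m * r := by
  obtain ⟨r, hr, hdet⟩ := exists_pos_det_vandermonde_exp m
  refine ⟨c ^ (4 * m + 1) * r, by positivity, ?_⟩
  rw [← LinearMap.det_toMatrix',
    ← Matrix.det_submatrix_equiv_self (ZMod.finEquiv (4 * m + 1)).toEquiv]
  have hM : (LinearMap.toMatrix' F).submatrix (ZMod.finEquiv (4 * m + 1)).toEquiv
      (ZMod.finEquiv (4 * m + 1)).toEquiv = (c : ℂ) • Matrix.vandermonde
        fun i : Fin (4 * m + 1) =>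
          Complex.exp (2 * Real.pi * Complex.I / (4 * m + 1 : ℕ)) ^ (i : ℕ) := by
    ext i j
    have hcast (k : Fin (4 * m + 1)) : ZMod.finEquiv (4 * m + 1) k = ((k : ℕ) : ZMod (4 * m + 1)) :=
      (ZMod.natCast_zmod_val (n := 4 * m + 1) k).symm
    have hval := ZMod.stdAddChar_coe (N := 4 * m + 1) ((j * i : ℕ) : ℤ)
    rw [Matrix.submatrix_apply, LinearMap.toMatrix'_apply, hF]
    simp only [Matrix.smul_apply, Matrix.vandermonde_apply, smul_eq_mul, Pi.single_apply,
      mul_ite, mul_one, mul_zero, Finset.sum_ite_eq', Finset.mem_univ, if_true,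
      RingEquiv.toEquiv_eq_coe, EquivLike.coe_coe, hcast]
    push_cast at hval
    rw [hval, ← pow_mul, ← Complex.exp_nat_mul]
    push_cast
    ring_nf
  rw [hM, Matrix.det_smul, hdet]
  simp only [Fintype.card_fin]
  push_cast
  ring

theorem eq_add_one_and_eq_of_trace_det {m a b c d : ℕ} {g : ℂ} {r : ℝ}
    (hdim : (a + b + c + d : ℂ) = 4 * m + 1) (htr2 : (a + b - c - d : ℂ) = 1)
    (htr : a - b + (c - d) * Complex.I = g) (hg : Complex.normSq g = 1)
    (hr : 0 < r) (hdet : (-1) ^ b * Complex.I ^ c * (-Complex.I) ^ d = ((-1) ^ m * r : ℂ)) :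
    a = m + 1 ∧ b = m ∧ c = m ∧ d = m := by
  have h1 : (a + b + c + d : ℤ) = 4 * m + 1 := by exact_mod_cast hdim
  have h2 : (a + b - c - d : ℤ) = 1 := by exact_mod_cast htr2
  have h3 : ((a - b) ^ 2 + (c - d) ^ 2 : ℤ) = 1 := by
    rw [← htr, Complex.normSq_apply] at hg
    simp at hg
    rw [← sq, ← sq] at hg
    exact_mod_cast hg
  have hab : (a : ℤ) - b ≠ 0 := by omega
  have hab' : 1 ≤ ((a : ℤ) - b) ^ 2 := by have := sq_pos_of_ne_zero hab; omega
  have hcd : (c : ℤ) - d = 0 := by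
    have : ((c : ℤ) - d) ^ 2 = 0 := by nlinarith [sq_nonneg ((c : ℤ) - d)]
    exact pow_eq_zero_iff two_ne_zero |>.mp this
  have hc : c = m := by omega
  have hd : d = m := by omega
  have hab1 : ((a : ℤ) - b) ^ 2 = 1 := by rw [hcd] at h3; linarith
  rcases mul_self_eq_one_iff.mp ((sq _).symm.trans hab1) with h | h
  · omega
  · exfalso
    have hb : b = m + 1 := by omega
    rw [hb, hc, hd, mul_assoc, ← mul_pow, mul_neg, Complex.I_mul_I, neg_neg, one_pow, mul_one,
      pow_succ] at hdet
    have hm : ((-1 : ℂ) ^ m) ≠ 0 := by simp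
    have : (-1 : ℂ) = r := mul_left_cancel₀ hm hdet
    have : (-1 : ℝ) = r := by exact_mod_cast this
    linarith


/-- With p = 4m+1, the DFT is diagonalizable with eigenvalues among
{1, −1, i, −i}, and its eigenspace dimensions are m+1 for 1 and m for each of
−1, i, −i. -/
theorem dft_eigenspace_dimensions (p : ℕ) [Fact p.Prime]
    (m : ℕ) (hm : p = 4 * m + 1)
    (η : ℂ) (hη : η = Complex.exp (2 * Real.pi * Complex.I / (p : ℂ)))
    (F : (ZMod p → ℂ) →ₗ[ℂ] (ZMod p → ℂ))
    (hF : ∀ φ : ZMod p → ℂ, ∀ j : ZMod p,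
      F φ j = (1 / Real.sqrt p : ℂ) * ∑ i : ZMod p, η ^ (i * j).val * φ i) :
    (⨆ μ ∈ ({1, -1, Complex.I, -Complex.I} : Set ℂ),
        Module.End.eigenspace (F : Module.End ℂ (ZMod p → ℂ)) μ) = ⊤ ∧
    Module.finrank ℂ
        (Module.End.eigenspace (F : Module.End ℂ (ZMod p → ℂ)) 1) = m + 1 ∧
    Module.finrank ℂ
        (Module.End.eigenspace (F : Module.End ℂ (ZMod p → ℂ)) (-1)) = m ∧
    Module.finrank ℂ
        (Module.End.eigenspace (F : Module.End ℂ (ZMod p → ℂ)) Complex.I) = m ∧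
    Module.finrank ℂ
        (Module.End.eigenspace (F : Module.End ℂ (ZMod p → ℂ)) (-Complex.I)) = m := by
  have hpF : NeZero p := ⟨(Fact.out : p.Prime).ne_zero⟩
  have hF' (φ : ZMod p → ℂ) (j : ZMod p) :
      F φ j = (1 / Real.sqrt p : ℂ) * ∑ i, ZMod.stdAddChar (i * j) * φ i := by
    simp_rw [hF, hη, ZMod.exp_pow_val_eq_stdAddChar]
  have hFF := ZMod.apply_apply_of_eq_stdAddChar_sum F hF'
  have htop := Module.End.iSup_eigenspace_eq_top_of_pow_four_eq_one F fun v => by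
    simp [hFF]
  refine ⟨htop, ?_⟩
  have hp0 : (0 : ℝ) < p := by exact_mod_cast (Fact.out : p.Prime).pos
  have h2 : (2 : ZMod p) ≠ 0 := by
    intro h
    have := (ZMod.natCast_eq_zero_iff 2 p).mp (by exact_mod_cast h)
    have := Nat.le_of_dvd two_pos this
    have := (Fact.out : p.Prime).two_le
    omega
  classical
  have h1n : (1 : ℂ) ≠ -1 := by norm_num
  have h1I : (1 : ℂ) ≠ Complex.I := by simp [Complex.ext_iff]
  have h1nI : (1 : ℂ) ≠ -Complex.I := by simp [Complex.ext_iff]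
  have hnI : (-1 : ℂ) ≠ Complex.I := by simp [Complex.ext_iff]
  have hnnI : (-1 : ℂ) ≠ -Complex.I := by simp [Complex.ext_iff]
  have hII : Complex.I ≠ -Complex.I := by norm_num [Complex.ext_iff]
  have hs : ⨆ μ ∈ ({1, -1, Complex.I, -Complex.I} : Finset ℂ), Module.End.eigenspace F μ = ⊤ := by
    simpa using htop
  have htrace := Module.End.trace_pow_eq_sum_finrank_eigenspace F _ hs
  have hdet := Module.End.det_eq_prod_pow_finrank_eigenspace F _ hs
  simp only [Finset.sum_insert, Finset.prod_insert, Finset.mem_insert, Finset.mem_singleton,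
    Finset.sum_singleton, Finset.prod_singleton, h1n, h1I, h1nI, hnI, hnnI, hII, or_self,
    not_false_eq_true] at htrace hdet
  obtain ⟨r, hr, hr'⟩ : ∃ r : ℝ, 0 < r ∧ LinearMap.det F = (-1) ^ m * r := by
    subst hm
    refine exists_pos_det_eq_of_apply_eq_sum m F (1 / Real.sqrt (4 * m + 1 : ℕ)) (by positivity) ?_
    simpa using hF'
  have hdim : LinearMap.trace ℂ _ (F ^ 0) = 4 * m + 1 := by
    rw [pow_zero, LinearMap.trace_one, Module.finrank_fintype_fun_eq_card, ZMod.card]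
    exact_mod_cast hm
  have htr2 : LinearMap.trace ℂ _ (F ^ 2) = 1 := by
    rw [LinearMap.trace_pi_eq_sum]
    have hneg (i : ZMod p) : -i = i ↔ i = 0 := by
      rw [neg_eq_iff_add_eq_zero, ← two_mul, mul_eq_zero, or_iff_right h2]
    simp [pow_two, hFF, Pi.single_apply, hneg]
  have htr : LinearMap.trace ℂ _ (F ^ 1) =
      (1 / Real.sqrt p : ℝ) * ∑ x : ZMod p, ZMod.stdAddChar (x * x) := by
    rw [pow_one, LinearMap.trace_pi_eq_sum]
    simp [hF', Pi.single_apply, Finset.mul_sum]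
  have hg : Complex.normSq ((1 / Real.sqrt p : ℝ) * ∑ x : ZMod p, ZMod.stdAddChar (x * x)) = 1 := by
    rw [Complex.normSq_mul, AddChar.normSq_sum_sq h2 (ZMod.isPrimitive_stdAddChar p),
      Complex.normSq_ofReal, ZMod.card, div_mul_div_comm, Real.mul_self_sqrt hp0.le, one_mul,
      one_div_mul_cancel hp0.ne']
  rw [htrace] at hdim htr2 htr
  rw [hdet] at hr'
  refine eq_add_one_and_eq_of_trace_det ?_ ?_ ?_ hg hr ?_
  · linear_combination hdim
  · simp only [neg_sq, Complex.I_sq] at htr2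
    linear_combination htr2
  · linear_combination htr
  · rw [← hr', one_pow]
    ring
end
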